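/- arXiv:2208.08668 — 2 statements merged into one kernel-verified Lean document; each statement's English description precedes it below -/
import Mathlib

section
/- Let a < b be real numbers and let f : [a,b] → ℝ be a probability density (f ≥ 0 and ∫_a^b f = 1) with sup_{t∈[a,b]} f(t) ≤ M for some M > 0. Let g : [a,b] → ℝ be a bounded measurable function and set ε = sup_{t∈[a,b]} |g(t) − f(t)|. If ε (b − a) ≤ 1/2, then ∫_a^b max{0, g(s)} ds ≥ 1/2 > 0, and the normalized function g̃(t) = max{0, g(t)} / ∫_a^b max{0, g(s)} ds satisfies sup_{t∈[a,b]} |g̃(t) − f(t)| ≤ 2(1 + M(b−a)) ε. -/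
/-- Taking the positive part does not increase the distance to a nonnegative number. -/
theorem abs_max_zero_sub_le {x y : ℝ} (hy : 0 ≤ y) : |max 0 x - y| ≤ |x - y| := by
  simpa [max_eq_right hy] using abs_max_sub_max_le_max 0 x 0 y

/-- A uniform bound on `Icc a b` for the difference of two integrable functions bounds the
difference of their integrals. -/
theorem abs_setIntegral_Icc_sub_le {a b ε : ℝ} (hab : a ≤ b) {u v : ℝ → ℝ}
    (hu : MeasureTheory.IntegrableOn u (Set.Icc a b))
    (hv : MeasureTheory.IntegrableOn v (Set.Icc a b))
    (h : ∀ t ∈ Set.Icc a b, |u t - v t| ≤ ε) :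
    |(∫ t in Set.Icc a b, u t) - ∫ t in Set.Icc a b, v t| ≤ ε * (b - a) := by
  rw [← MeasureTheory.integral_sub hu hv]
  simpa [Real.volume_real_Icc_of_le hab] using
    MeasureTheory.norm_setIntegral_le_of_norm_le_const (μ := MeasureTheory.volume)
      (f := fun t => u t - v t) measure_Icc_lt_top h

/-- Remark 1 of the paper: if `f` is a probability density on `[a,b]` bounded by `M`, `g`
is a bounded measurable function with uniform error `ε` from `f`, and `ε(b−a) ≤ 1/2`,
then `∫ max{0,g} ≥ 1/2 > 0` and the normalized estimator `max{0,g}/∫max{0,g}` has uniform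
error at most `2(1 + M(b−a))ε` from `f`. -/
theorem stmt_13 (a b : ℝ) (hab : a < b) (M : ℝ) (hM : 0 < M)
    (f : ℝ → ℝ) (hfm : Measurable f) (hf0 : ∀ t ∈ Set.Icc a b, 0 ≤ f t)
    (hf1 : ∫ t in Set.Icc a b, f t = 1) (hfM : ∀ t ∈ Set.Icc a b, f t ≤ M)
    (g : ℝ → ℝ) (hgm : Measurable g) (hgb : ∃ C, ∀ t ∈ Set.Icc a b, |g t| ≤ C)
    (ε : ℝ) (hε : ∀ t ∈ Set.Icc a b, |g t - f t| ≤ ε) (hεs : ε * (b - a) ≤ 1 / 2) :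
    (1 / 2 : ℝ) ≤ ∫ s in Set.Icc a b, max 0 (g s) ∧
    (0 : ℝ) < ∫ s in Set.Icc a b, max 0 (g s) ∧
    ∀ t ∈ Set.Icc a b,
      |max 0 (g t) / (∫ s in Set.Icc a b, max 0 (g s)) - f t| ≤
        2 * (1 + M * (b - a)) * ε := by
  obtain ⟨C, hC⟩ := hgb
  have hfi : MeasureTheory.IntegrableOn f (Set.Icc a b) := by
    by_contra h
    rw [MeasureTheory.integral_undef h] at hf1
    exact zero_ne_one hf1
  have hgi : MeasureTheory.IntegrableOn (fun s => max 0 (g s)) (Set.Icc a b) := by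
    refine MeasureTheory.Measure.integrableOn_of_bounded (M := C) measure_Icc_lt_top.ne
      (measurable_const.max hgm).aestronglyMeasurable ?_
    filter_upwards [MeasureTheory.ae_restrict_mem measurableSet_Icc] with t ht
    have h := abs_max_zero_sub_le (x := g t) le_rfl
    rw [sub_zero, sub_zero] at h
    exact h.trans (hC t ht)
  have hdist : ∀ t ∈ Set.Icc a b, |max 0 (g t) - f t| ≤ ε := fun t ht =>
    (abs_max_zero_sub_le (hf0 t ht)).trans (hε t ht)
  have hint := abs_setIntegral_Icc_sub_le hab.le hgi hfi hdist
  rw [hf1] at hint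
  set I := ∫ s in Set.Icc a b, max 0 (g s)
  have hI : 1 / 2 ≤ I := by linarith [(abs_le.mp hint).1]
  have hI0 : 0 < I := by linarith
  refine ⟨hI, hI0, fun t ht => ?_⟩
  have hε0 : 0 ≤ ε := (abs_nonneg _).trans (hε t ht)
  have hb : 0 ≤ b - a := sub_nonneg.mpr hab.le
  have hsplit : max 0 (g t) / I - f t = ((max 0 (g t) - f t) - f t * (I - 1)) / I := by
    field_simp
    ring
  rw [hsplit, abs_div, abs_of_pos hI0, div_le_iff₀ hI0]
  calc |(max 0 (g t) - f t) - f t * (I - 1)|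
      ≤ |max 0 (g t) - f t| + |f t * (I - 1)| := abs_sub _ _
    _ ≤ ε + M * (ε * (b - a)) := by
      rw [abs_mul, abs_of_nonneg (hf0 t ht)]
      gcongr
      exacts [hdist t ht, hfM t ht]
    _ = 2 * (1 + M * (b - a)) * ε * (1 / 2) := by ring
    _ ≤ 2 * (1 + M * (b - a)) * ε * I := by gcongr
end

section
/- For all h ∈ (0,1), C_q > 0 and c∘ ∈ (0,1), there exists a real number c⋆ ≥ 2 such that for every integer j ≥ 1, c∘ · ⌊(C_q c⋆ j)^{1/h}⌋ − 1 > ⌊(C_q (j+1))^{1/h}⌋. -/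
/-- For the basis-activation schedule `S(x) = ⌊(C_q x)^(1/h)⌋` of the paper's
pre-estimation strategy (Section 2.3): for all `h ∈ (0,1)`, `C_q > 0`, `c∘ ∈ (0,1)`
there is `c⋆ ≥ 2` with `c∘ S(c⋆ j) − 1 > S(j+1)` for every integer `j ≥ 1`. -/
theorem stmt_14 (h Cq c0 : ℝ) (hh : h ∈ Set.Ioo (0:ℝ) 1) (hCq : 0 < Cq)
    (hc0 : c0 ∈ Set.Ioo (0:ℝ) 1) :
    ∃ cstar : ℝ, 2 ≤ cstar ∧ ∀ j : ℕ, 1 ≤ j →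
      (⌊(Cq * ((j : ℝ) + 1)) ^ (1 / h)⌋₊ : ℝ) <
        c0 * (⌊(Cq * cstar * (j : ℝ)) ^ (1 / h)⌋₊ : ℝ) - 1 := by
  obtain ⟨hh0, hh1⟩ := hh
  obtain ⟨hc0, hc1⟩ := hc0
  have hp : 1 ≤ 1 / h := by rw [le_div_iff₀ hh0]; linarith
  set p := 1 / h
  set m := (Cq * 2) ^ p
  have hm : 0 < m := by positivity
  set t := (1 + 2 / m) / c0
  have hct : c0 * t = 1 + 2 / m := mul_div_cancel₀ _ hc0.ne'
  have ht : 1 ≤ t := by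
    rw [le_div_iff₀ hc0]
    have : 0 < 2 / m := by positivity
    linarith
  refine ⟨2 * t, by linarith, fun j hj => ?_⟩
  have hj' : (1 : ℝ) ≤ j := by exact_mod_cast hj
  have hmX : m ≤ (Cq * ((j : ℝ) + 1)) ^ p := by
    apply Real.rpow_le_rpow (by positivity) _ (by linarith)
    gcongr
    linarith
  set X := (Cq * ((j : ℝ) + 1)) ^ p with hX
  have hXpos : 0 < X := hm.trans_le hmX
  have hA : t * X ≤ (Cq * (2 * t) * (j : ℝ)) ^ p := by
    calc t * X ≤ t ^ p * X := by
          gcongr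
          exact Real.self_le_rpow_of_one_le ht hp
      _ = (t * (Cq * ((j : ℝ) + 1))) ^ p := by
          rw [hX, Real.mul_rpow (x := t) (by positivity) (by positivity)]
      _ ≤ _ := by
          apply Real.rpow_le_rpow (by positivity) _ (by linarith)
          have : 0 < t * Cq := by positivity
          nlinarith
  have h_floor_lower := Nat.lt_floor_add_one ((Cq * (2 * t) * (j : ℝ)) ^ p)
  have h_floor_upper : (⌊X⌋₊ : ℝ) ≤ X := Nat.floor_le hXpos.le
  have h_gain : 2 ≤ 2 / m * X := by
    rw [div_mul_eq_mul_div, le_div_iff₀ hm]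
    linarith
  have h_scaled : c0 * (t * X - 1) <
      c0 * (⌊(Cq * (2 * t) * (j : ℝ)) ^ p⌋₊ : ℝ) :=
    mul_lt_mul_of_pos_left (by linarith) hc0
  have h_expand : c0 * (t * X - 1) = X + 2 / m * X - c0 := by
    linear_combination X * hct
  linarith
end
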